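/- arXiv:2501.02466 — 2 statements merged into one kernel-verified Lean document; each statement's English description precedes it below -/
import Mathlib

section
/- Let I be a two-sided ideal of an artin algebra A. Then |A| = |A/I| + st(I), where |M| denotes the number of isomorphism classes of indecomposable direct summands of a module M, and st(I) = |P₀| for the unique basic projective A-module P₀ with tr(P₀) equal to the stable part of I. -/
section Defs

variable (B : Type) [Ring B]

/-- `M` is a direct summand of `N`. -/
def isSummand (M N : Type) [AddCommGroup M] [Module B M] [AddCommGroup N] [Module B N] :
    Prop :=
  ∃ (s : M →ₗ[B] N) (r : N →ₗ[B] M), r.comp s = LinearMap.id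

/-- `M` is an indecomposable module. -/
def isIndec (M : Type) [AddCommGroup M] [Module B M] : Prop :=
  Nontrivial M ∧ ∀ (X Y : Type) [AddCommGroup X] [Module B X] [AddCommGroup Y] [Module B Y],
    Nonempty (M ≃ₗ[B] X × Y) → Subsingleton X ∨ Subsingleton Y

/-- The setoid identifying isomorphic modules satisfying a given predicate. -/
def isoSetoid (pred : ModuleCat B → Prop) : Setoid {N : ModuleCat B // pred N} where
  r X Y := Nonempty (↥X.1 ≃ₗ[B] ↥Y.1)
  iseqv := ⟨fun _ => ⟨LinearEquiv.refl B _⟩, fun ⟨e⟩ => ⟨e.symm⟩, fun ⟨e⟩ ⟨f⟩ => ⟨e.trans f⟩⟩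

/-- `|M|`: the number of isomorphism classes of indecomposable direct summands of `M`. -/
noncomputable def numIndec (M : Type) [AddCommGroup M] [Module B M] : ℕ :=
  Nat.card (Quotient (isoSetoid B (fun N => isIndec B ↥N ∧ isSummand B (↥N) M)))

/-- A module is basic if no indecomposable occurs twice as a direct summand. -/
def isBasic (M : Type) [AddCommGroup M] [Module B M] : Prop :=
  ∀ N : ModuleCat B, isIndec B ↥N → ¬ isSummand B (↥N × ↥N) M

/-- The trace ideal of a module `P`. -/
def traceIdeal (P : Type) [AddCommGroup P] [Module B P] : Ideal B :=
  ⨆ f : P →ₗ[B] B, LinearMap.range f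

/-- A two-sided ideal is idempotent if `I = I²`. -/
def IsIdem (J : TwoSidedIdeal B) : Prop :=
  J.asIdeal = Submodule.span B {x : B | ∃ a ∈ J, ∃ b ∈ J, x = a * b}

end Defs

theorem aux_card_quot {α β : Type*} (sa : Setoid α) (sb : Setoid β) (T : α → β → Prop)
    (h1 : ∀ a, ∃ b, T a b) (h2 : ∀ b, ∃ a, T a b)
    (h3 : ∀ a a' b b', T a b → T a' b' → (sa a a' ↔ sb b b')) :
    Nat.card (Quotient sa) = Nat.card (Quotient sb) := by
  choose f hf using h1
  refine Nat.card_congr (Equiv.ofBijective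
    (Quotient.map f (fun a a' h => (h3 _ _ _ _ (hf a) (hf a')).1 h)) ⟨?_, ?_⟩)
  · intro x y
    refine Quotient.inductionOn₂ x y fun a a' h => ?_
    rw [Quotient.map_mk, Quotient.map_mk] at h
    exact Quotient.sound ((h3 _ _ _ _ (hf a) (hf a')).2 (Quotient.exact h))
  · intro y
    refine Quotient.inductionOn y fun b => ?_
    obtain ⟨a, ha⟩ := h2 b
    refine ⟨Quotient.mk _ a, ?_⟩
    rw [Quotient.map_mk]
    exact Quotient.sound ((h3 _ _ _ _ (hf a) ha).1 (sa.refl a))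

section aux
variable {A : Type} [Ring A]

theorem aux_split (p q : ModuleCat.{0} A → Prop)
    (hq : ∀ X Y : ModuleCat.{0} A, Nonempty (X ≃ₗ[A] Y) → q X → q Y)
    (hfin : Finite (Quotient (isoSetoid A p))) :
    Nat.card (Quotient (isoSetoid A p)) =
      Nat.card (Quotient (isoSetoid A (fun N => p N ∧ q N))) +
      Nat.card (Quotient (isoSetoid A (fun N => p N ∧ ¬ q N))) := by
  let f1 : Quotient (isoSetoid A (fun N => p N ∧ q N)) → Quotient (isoSetoid A p) :=
    Quotient.map (fun N => ⟨N.1, N.2.1⟩) (fun _ _ h => h)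
  let f2 : Quotient (isoSetoid A (fun N => p N ∧ ¬ q N)) → Quotient (isoSetoid A p) :=
    Quotient.map (fun N => ⟨N.1, N.2.1⟩) (fun _ _ h => h)
  have i1 : Function.Injective f1 := by
    intro x y
    refine Quotient.inductionOn₂ x y fun a a' h => ?_
    exact Quotient.sound (s := isoSetoid A (fun N => p N ∧ q N)) (Quotient.exact (s := isoSetoid A p) h)
  have i2 : Function.Injective f2 := by
    intro x y
    refine Quotient.inductionOn₂ x y fun a a' h => ?_
    exact Quotient.sound (s := isoSetoid A (fun N => p N ∧ ¬ q N)) (Quotient.exact (s := isoSetoid A p) h)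
  have := Finite.of_injective f1 i1
  have := Finite.of_injective f2 i2
  rw [← Nat.card_sum]
  symm
  refine Nat.card_congr (Equiv.ofBijective (Sum.elim f1 f2) ⟨?_, ?_⟩)
  · refine Function.Injective.sumElim i1 i2 ?_
    intro x y
    refine Quotient.inductionOn₂ x y fun a a' h => ?_
    exact a'.2.2 (hq _ _ (Quotient.exact h) a.2.2)
  · intro y
    refine Quotient.inductionOn y fun b => ?_
    by_cases hb : q b.1
    · exact ⟨Sum.inl (Quotient.mk _ ⟨b.1, b.2, hb⟩), rfl⟩
    · exact ⟨Sum.inr (Quotient.mk _ ⟨b.1, b.2, hb⟩), rfl⟩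

/-- kernel comparison gives isomorphic simples -/
theorem aux_iso {M S S' : Type} [AddCommGroup M] [Module A M] [AddCommGroup S] [Module A S]
    [AddCommGroup S'] [Module A S'] [IsSimpleModule A S] [IsSimpleModule A S']
    (f : M →ₗ[A] S) (f' : M →ₗ[A] S') (hf : f ≠ 0) (hf' : f' ≠ 0)
    (h : LinearMap.ker f ≤ LinearMap.ker f') : Nonempty (S ≃ₗ[A] S') := by
  have hs := LinearMap.surjective_of_ne_zero hf
  have hs' := LinearMap.surjective_of_ne_zero hf'
  have c := LinearMap.isCoatom_ker_of_surjective hs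
  have c' := LinearMap.isCoatom_ker_of_surjective hs'
  have e : LinearMap.ker f = LinearMap.ker f' := by
    rcases h.eq_or_lt with h | h
    · exact h
    · exact absurd (c.2 _ h) c'.1
  exact ⟨(f.quotKerEquivOfSurjective hs).symm ≪≫ₗ Submodule.quotEquivOfEq _ _ e ≪≫ₗ
    f'.quotKerEquivOfSurjective hs'⟩

theorem aux_finite_list {M : Type} [AddCommGroup M] [Module A M] (h : IsFiniteLength A M) :
    ∃ L : List (ModuleCat.{0} A), ∀ (S : ModuleCat.{0} A), IsSimpleModule A S →
      ∀ f : M →ₗ[A] S, f ≠ 0 → ∃ X ∈ L, Nonempty (X ≃ₗ[A] S) := by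
  induction h with
  | of_subsingleton =>
    refine ⟨[], fun S _ f hf => (hf ?_).elim⟩
    ext x
    rw [Subsingleton.elim x 0]; simp
  | @of_simple_quotient M _ _ N hN _ ih =>
    obtain ⟨L, hL⟩ := ih
    refine ⟨ModuleCat.of A (M ⧸ N) :: L, fun S hS f hf => ?_⟩
    by_cases hz : f.comp N.subtype = 0
    · refine ⟨_, List.mem_cons_self, ?_⟩
      have := hN.nontrivial
      refine aux_iso (M := M) (S := M ⧸ N) N.mkQ f ?_ hf ?_
      · intro h0
        obtain ⟨x, hx⟩ := exists_ne (0 : M ⧸ N)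
        obtain ⟨y, rfl⟩ := N.mkQ_surjective x
        exact hx (by rw [h0]; rfl)
      · rw [Submodule.ker_mkQ]
        intro x hx
        exact LinearMap.congr_fun hz ⟨x, hx⟩
    · obtain ⟨X, hX, e⟩ := hL S hS _ hz
      exact ⟨X, List.mem_cons_of_mem _ hX, e⟩

theorem aux_self_hom (S : Type) [AddCommGroup S] [Module A S] [hS : IsSimpleModule A S] :
    ∃ f : A →ₗ[A] S, f ≠ 0 := by
  have := hS.nontrivial
  obtain ⟨x, hx⟩ := exists_ne (0 : S)
  refine ⟨LinearMap.toSpanSingleton A S x, fun h => hx ?_⟩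
  simpa using LinearMap.congr_fun h 1

theorem aux_finite [IsArtinianRing A] :
    Finite (Quotient (isoSetoid A (fun S : ModuleCat.{0} A => IsSimpleModule A S))) := by
  obtain ⟨L, hL⟩ := aux_finite_list (A := A) (M := A)
    (isFiniteLength_iff_isNoetherian_isArtinian.2 ⟨inferInstance, inferInstance⟩)
  have key : ∀ S : {S : ModuleCat.{0} A // IsSimpleModule A S},
      ∃ X : {X // X ∈ L}, Nonempty (X.1 ≃ₗ[A] S.1) := by
    rintro ⟨S, hS⟩
    obtain ⟨f, hf⟩ := aux_self_hom (A := A) S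
    obtain ⟨X, hX, e⟩ := hL S hS f hf
    exact ⟨⟨X, hX⟩, e⟩
  choose g hg using key
  have : Finite {X // X ∈ L} := List.finite_toSet L
  refine Finite.of_injective (fun q : Quotient (isoSetoid A (fun S : ModuleCat.{0} A => IsSimpleModule A S)) =>
    g q.out) ?_
  intro x y hxy
  obtain ⟨e1⟩ := hg x.out
  obtain ⟨e2⟩ := hg y.out
  simp only at hxy
  rw [hxy] at e1
  rw [← x.out_eq, ← y.out_eq]
  exact Quotient.sound ⟨e1.symm ≪≫ₗ e2⟩

theorem aux_range_top {M N S : Type} [AddCommGroup M] [Module A M] [AddCommGroup N] [Module A N]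
    [AddCommGroup S] [Module A S] [IsSimpleModule A S] [IsArtinian A N] [IsNoetherian A N]
    [Module.Projective A N] (hN : isIndec A N) (f : N →ₗ[A] S)
    (g : M →ₗ[A] N) (hg : f.comp g ≠ 0) : LinearMap.range g = ⊤ := by
  obtain ⟨h, hh⟩ := Module.projective_lifting_property (f.comp g) f
    (LinearMap.surjective_of_ne_zero hg)
  set u : Module.End A N := g.comp h with hu
  have hfu : f.comp u = f := by rw [hu, ← LinearMap.comp_assoc, hh]
  have hfn : ∀ n : ℕ, f.comp (u ^ n) = f := by
    intro n
    induction n with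
    | zero => rfl
    | succ n ih => rw [pow_succ', Module.End.mul_eq_comp, ← LinearMap.comp_assoc, hfu, ih]
  have hf0 : f ≠ 0 := by rintro rfl; simp at hg
  obtain ⟨n, hn⟩ := Filter.eventually_atTop.1 u.eventually_isCompl_ker_pow_range_pow
  have hc := hn (n + 1) (by omega)
  rcases hN.2 _ _ ⟨(Submodule.prodEquivOfIsCompl _ _ hc).symm⟩ with hk | hk
  · rw [Submodule.subsingleton_iff_eq_bot] at hk
    have hr := hc.sup_eq_top
    rw [hk, bot_sup_eq] at hr
    rw [eq_top_iff, ← hr]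
    rintro _ ⟨x, rfl⟩
    rw [pow_succ']
    exact ⟨h ((u ^ n) x), rfl⟩
  · rw [Submodule.subsingleton_iff_eq_bot, LinearMap.range_eq_bot] at hk
    have := hfn (n + 1)
    rw [hk] at this
    exact (hf0 (by rw [← this]; simp)).elim

theorem aux_exists_indec {P S : Type} [AddCommGroup P] [Module A P] [IsArtinian A P]
    [AddCommGroup S] [Module A S] (f : P →ₗ[A] S) (hf : f ≠ 0) :
    ∃ (N : ModuleCat.{0} A) (s : N →ₗ[A] P) (r : P →ₗ[A] N), r.comp s = LinearMap.id ∧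
      isIndec A N ∧ f.comp s ≠ 0 := by
  obtain ⟨K, ⟨N, s, r, hrs, hfs, rfl⟩, hmin⟩ := IsArtinian.set_has_minimal (R := A) (M := P)
    {K | ∃ (N : ModuleCat.{0} A) (s : N →ₗ[A] P) (r : P →ₗ[A] N), r.comp s = LinearMap.id ∧
      f.comp s ≠ 0 ∧ LinearMap.range s = K}
    ⟨_, ModuleCat.of A P, LinearMap.id, LinearMap.id, rfl, hf, rfl⟩
  have hinj : Function.Injective s := by
    intro x y h
    have := congrArg r h
    have h2 := LinearMap.congr_fun hrs
    simp only [LinearMap.comp_apply, LinearMap.id_apply] at h2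
    rwa [h2, h2] at this
  have key : ∀ (X Y : Type) [AddCommGroup X] [Module A X] [AddCommGroup Y] [Module A Y]
      (e : N ≃ₗ[A] X × Y),
      (f.comp s).comp (e.symm.toLinearMap.comp (LinearMap.inl A X Y)) ≠ 0 → Subsingleton Y := by
    intro X Y _ _ _ _ e hne
    have hle : LinearMap.range (s.comp (e.symm.toLinearMap.comp (LinearMap.inl A X Y))) ≤
      LinearMap.range s := LinearMap.range_comp_le_range _ _
    have hnlt := hmin _ ⟨ModuleCat.of A X, s.comp (e.symm.toLinearMap.comp (LinearMap.inl A X Y)),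
      (LinearMap.fst A X Y).comp (e.toLinearMap.comp r), by
        ext x
        have h2 := LinearMap.congr_fun hrs (e.symm (x, 0))
        simp only [LinearMap.comp_apply, LinearMap.id_apply] at h2
        simp [h2], hne, rfl⟩
    have heq := hle.eq_of_not_lt hnlt
    refine subsingleton_of_forall_eq 0 fun y => ?_
    have : s (e.symm (0, y)) ∈ LinearMap.range s := ⟨_, rfl⟩
    rw [← heq] at this
    obtain ⟨x, hx⟩ := this
    have := e.symm.injective (hinj hx)
    simp at this
    exact this.2.symm
  refine ⟨N, s, r, hrs, ⟨?_, ?_⟩, hfs⟩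
  · by_contra hnt
    rw [not_nontrivial_iff_subsingleton] at hnt
    refine hfs ?_
    ext x
    rw [Subsingleton.elim x 0]; simp
  · rintro X Y _ _ _ _ ⟨e⟩
    by_cases h1 : (f.comp s).comp (e.symm.toLinearMap.comp (LinearMap.inl A X Y)) = 0
    · left
      refine key Y X (e ≪≫ₗ LinearEquiv.prodComm A X Y) fun h2 => hfs ?_
      ext n
      obtain ⟨⟨x, y⟩, rfl⟩ := e.symm.surjective n
      have a1 := LinearMap.congr_fun h1 x
      have a2 := LinearMap.congr_fun h2 y
      simp at a1 a2
      have : ((x, y) : X × Y) = (x, 0) + (0, y) := by simp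
      rw [this, map_add, map_add]
      simp [a1, a2]
    · right; exact key X Y e h1

theorem aux_numIndec [IsArtinianRing A] (P : Type) [AddCommGroup P] [Module A P]
    [Module.Finite A P] [Module.Projective A P] :
    numIndec A P = Nat.card (Quotient (isoSetoid A
      (fun S : ModuleCat.{0} A => IsSimpleModule A S ∧ ∃ f : P →ₗ[A] S, f ≠ 0))) := by
  have inst : ∀ N : ModuleCat.{0} A, isSummand A N P → Module.Finite A N ∧ Module.Projective A N := by
    rintro N ⟨s, r, h⟩
    refine ⟨Module.Finite.of_surjective r fun x => ⟨s x, LinearMap.congr_fun h x⟩,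
      Module.Projective.of_split s r h⟩
  unfold numIndec
  apply aux_card_quot _ _ (fun N S => ∃ f : N.1 →ₗ[A] S.1, f ≠ 0)
  · rintro ⟨N, hN, hs⟩
    obtain ⟨_, _⟩ := inst N hs
    have := hN.1
    obtain ⟨m, hm⟩ := IsCoatomic.exists_coatom (Submodule A N)
    have hsim : IsSimpleModule A (N ⧸ m) := isSimpleModule_iff_isCoatom.2 hm
    have := hsim.nontrivial
    have hne : m.mkQ ≠ 0 := by
      intro h0
      obtain ⟨x, hx⟩ := exists_ne (0 : N ⧸ m)
      obtain ⟨y, rfl⟩ := m.mkQ_surjective x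
      exact hx (by rw [h0]; rfl)
    obtain ⟨s, r, h⟩ := hs
    refine ⟨⟨ModuleCat.of A (N ⧸ m), hsim, m.mkQ.comp r, fun h0 => hne ?_⟩, m.mkQ, hne⟩
    have : (m.mkQ.comp r).comp s = 0 := by
      rw [show m.mkQ.comp r = 0 from h0]; simp
    rwa [LinearMap.comp_assoc, h, LinearMap.comp_id] at this
  · rintro ⟨S, hS, f, hf⟩
    obtain ⟨N, s, r, hrs, hN, hfs⟩ := aux_exists_indec f hf
    exact ⟨⟨N, hN, s, r, hrs⟩, f.comp s, hfs⟩
  · rintro ⟨N, hN, hs⟩ ⟨N', hN', hs'⟩ ⟨S, hS, _⟩ ⟨S', hS', _⟩ ⟨f, hf⟩ ⟨f', hf'⟩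
    obtain ⟨_, _⟩ := inst N hs
    obtain ⟨_, _⟩ := inst N' hs'
    dsimp only at f f' hf hf'
    change Nonempty (N ≃ₗ[A] N') ↔ Nonempty (S ≃ₗ[A] S')
    constructor
    · rintro ⟨e⟩
      have hg : f'.comp e.toLinearMap ≠ 0 := by
        intro h
        apply hf'
        ext x
        obtain ⟨y, rfl⟩ := e.surjective x
        exact LinearMap.congr_fun h y
      refine aux_iso f (f'.comp e.toLinearMap) hf hg ?_
      by_contra hle
      have hz : (f'.comp e.toLinearMap).comp (LinearMap.ker f).subtype ≠ 0 := by
        intro h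
        exact hle fun x hx => LinearMap.congr_fun h ⟨x, hx⟩
      have := aux_range_top hN _ _ hz
      rw [Submodule.range_subtype, LinearMap.ker_eq_top] at this
      exact hf this
    · rintro ⟨e⟩
      have hs := LinearMap.surjective_of_ne_zero hf'
      obtain ⟨g, hg⟩ := Module.projective_lifting_property f' (e.toLinearMap.comp f) hs
      have hne : f'.comp g ≠ 0 := by
        rw [hg]
        intro h
        apply hf
        ext x
        exact e.injective (by simpa using LinearMap.congr_fun h x)
      have hsurj := LinearMap.range_eq_top.1 (aux_range_top hN' f' g hne)
      obtain ⟨t, ht⟩ := Module.projective_lifting_property g LinearMap.id hsurj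
      have hz : f.comp t ≠ 0 := by
        intro h
        apply hf'
        have : f' = (f'.comp g).comp t := by rw [LinearMap.comp_assoc, ht, LinearMap.comp_id]
        rw [this, hg, LinearMap.comp_assoc, h, LinearMap.comp_zero]
      have hts := LinearMap.range_eq_top.1 (aux_range_top hN f t hz)
      exact ⟨(LinearEquiv.ofBijective t
        ⟨Function.LeftInverse.injective (LinearMap.congr_fun ht), hts⟩).symm⟩

theorem aux_span_idem (e : A) (he : e * e = e) : IsIdem A (TwoSidedIdeal.span {e}) := by
  set J : TwoSidedIdeal A := TwoSidedIdeal.span {e} with hJ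
  unfold IsIdem
  set L := Submodule.span A {x : A | ∃ a ∈ J, ∃ b ∈ J, x = a * b} with hL
  have heJ : e ∈ J := TwoSidedIdeal.subset_span (by simp)
  apply le_antisymm
  · have hr : ∀ x y : A, x ∈ L → x * y ∈ L := by
      intro x y hx
      induction hx using Submodule.span_induction with
      | mem x h =>
        obtain ⟨a, ha, b, hb, rfl⟩ := h
        exact Submodule.subset_span ⟨a, ha, b * y, J.mul_mem_right _ _ hb, mul_assoc _ _ _⟩
      | zero => simp
      | add a b _ _ h1 h2 => rw [add_mul]; exact L.add_mem h1 h2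
      | smul a b _ h => rw [smul_mul_assoc]; exact L.smul_mem _ h
    let L' : TwoSidedIdeal A := TwoSidedIdeal.mk' (L : Set A) L.zero_mem
      (fun h1 h2 => L.add_mem h1 h2) (fun h => L.neg_mem h)
      (fun {x y} h => L.smul_mem x h) (fun {x y} h => hr x y h)
    have : J ≤ L' := by
      rw [hJ, TwoSidedIdeal.span_le]
      rintro _ rfl
      change _ ∈ L'
      rw [TwoSidedIdeal.mem_mk']
      exact Submodule.subset_span ⟨_, heJ, _, heJ, he.symm⟩
    intro x hx
    have := this (TwoSidedIdeal.mem_asIdeal.1 hx)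
    rwa [TwoSidedIdeal.mem_mk'] at this
  · rw [hL, Submodule.span_le]
    rintro _ ⟨a, ha, b, hb, rfl⟩
    exact TwoSidedIdeal.mem_asIdeal.2 (J.mul_mem_left _ _ hb)

theorem aux_hom_iff [IsArtinianRing A] (I I₀ : TwoSidedIdeal A)
    (h₀le : ∀ x ∈ I₀, x ∈ I)
    (h₀max : ∀ J : TwoSidedIdeal A, IsIdem A J → (∀ x ∈ J, x ∈ I) → ∀ x ∈ J, x ∈ I₀)
    (P₀ : Type) [AddCommGroup P₀] [Module A P₀] [Module.Projective A P₀]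
    (htr : traceIdeal A P₀ = I₀.asIdeal)
    (S : Type) [AddCommGroup S] [Module A S] [IsSimpleModule A S] :
    (∃ f : P₀ →ₗ[A] S, f ≠ 0) ↔ ¬ ∀ x ∈ I, ∀ s : S, x • s = 0 := by
  constructor
  · rintro ⟨g, hg⟩ hI
    apply hg
    obtain ⟨t, ht⟩ := Module.projective_def'.1 (inferInstance : Module.Projective A P₀)
    ext p
    have h1 := LinearMap.congr_fun ht p
    simp only [LinearMap.comp_apply, LinearMap.id_apply] at h1
    rw [← h1, Finsupp.linearCombination_apply, Finsupp.sum, map_sum]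
    refine Finset.sum_eq_zero fun q _ => ?_
    rw [map_smul]
    apply hI
    apply h₀le
    rw [← TwoSidedIdeal.mem_asIdeal, ← htr]
    exact Submodule.mem_iSup_of_mem ((Finsupp.lapply q).comp t) ⟨p, rfl⟩
  · intro hI
    push Not at hI
    obtain ⟨x, hx, y, hxy⟩ := hI
    obtain ⟨f₀, hf₀⟩ := aux_self_hom (A := A) S
    obtain ⟨N, s, r, hrs, hN, hfs⟩ := aux_exists_indec f₀ hf₀
    have : Module.Finite A N :=
      Module.Finite.of_surjective r fun x => ⟨s x, LinearMap.congr_fun hrs x⟩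
    have : Module.Projective A N := Module.Projective.of_split s r hrs
    have hrs' : ∀ n, r (s n) = n := LinearMap.congr_fun hrs
    set f := f₀.comp s with hf
    have hfsurj := LinearMap.surjective_of_ne_zero hfs
    let K : Submodule A N := Submodule.comap s I.asIdeal
    have hK : f.comp K.subtype ≠ 0 := by
      intro h
      obtain ⟨n, rfl⟩ := hfsurj y
      apply hxy
      have hmem : x • n ∈ K := by
        change s (x • n) ∈ I.asIdeal
        rw [map_smul, smul_eq_mul, TwoSidedIdeal.mem_asIdeal]
        exact I.mul_mem_right _ _ hx
      have := LinearMap.congr_fun h ⟨x • n, hmem⟩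
      simpa only [LinearMap.comp_apply, Submodule.subtype_apply, map_smul, LinearMap.zero_apply] using this
    have hKtop := aux_range_top hN f K.subtype hK
    rw [Submodule.range_subtype] at hKtop
    set e : A := s (r 1) with he
    have heI : e ∈ I := by
      have : r 1 ∈ K := by rw [hKtop]; trivial
      exact TwoSidedIdeal.mem_asIdeal.1 this
    have hre : e • r 1 = r 1 := by
      rw [← map_smul, smul_eq_mul, mul_one, he, hrs']
    have hee : e * e = e := by
      conv_lhs => rw [← smul_eq_mul]; rhs; rw [he]
      rw [← map_smul, hre]
    have hsp : ∀ z ∈ TwoSidedIdeal.span {e}, z ∈ I := by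
      have : TwoSidedIdeal.span {e} ≤ I := by
        rw [TwoSidedIdeal.span_le]
        rintro _ rfl
        exact heI
      exact fun z hz => this hz
    have heI₀ := h₀max _ (aux_span_idem e hee) hsp e (TwoSidedIdeal.subset_span (by simp))
    rw [← TwoSidedIdeal.mem_asIdeal, ← htr] at heI₀
    by_contra hno
    push Not at hno
    have hle : traceIdeal A P₀ ≤ LinearMap.ker (LinearMap.toSpanSingleton A S (f (r 1))) := by
      unfold traceIdeal
      refine iSup_le fun h => ?_
      rintro _ ⟨p, rfl⟩
      exact LinearMap.congr_fun (hno ((LinearMap.toSpanSingleton A S (f (r 1))).comp h)) p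
    have h0 := hle heI₀
    rw [LinearMap.mem_ker, LinearMap.toSpanSingleton_apply, ← map_smul, hre] at h0
    apply hfs
    ext n
    have : n = s n • r 1 := by rw [← map_smul, smul_eq_mul, mul_one, hrs']
    rw [this, map_smul, h0, smul_zero, LinearMap.zero_apply]

theorem aux_quot (I : TwoSidedIdeal A) (B : Type) [Ring B] (φ : A →+* B)
    (hsurj : Function.Surjective φ) (hker : ∀ a : A, φ a = 0 ↔ a ∈ I) :
    Nat.card (Quotient (isoSetoid B
      (fun S : ModuleCat.{0} B => IsSimpleModule B S ∧ ∃ f : B →ₗ[B] S, f ≠ 0))) =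
    Nat.card (Quotient (isoSetoid A
      (fun S : ModuleCat.{0} A => IsSimpleModule A S ∧ ∀ x ∈ I, ∀ s : S, x • s = 0))) := by
  have : RingHomSurjective φ := ⟨hsurj⟩
  symm
  apply aux_card_quot _ _ (fun S U => ∃ l : S.1 →ₛₗ[φ] U.1, Function.Bijective l)
  · rintro ⟨S, hS, hI⟩
    let g : B →+* AddMonoid.End S := φ.liftOfSurjective hsurj ⟨Module.toAddMonoidEnd A S, by
      intro a ha
      ext s
      exact hI a ((hker a).1 ha) s⟩
    have hg : ∀ a, g (φ a) = Module.toAddMonoidEnd A S a := fun a =>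
      RingHom.liftOfSurjective_comp_apply φ hsurj _ a
    let _ : Module B S := Module.compHom S g
    have hsm : ∀ (a : A) (s : S), φ a • s = a • s := fun a s => by
      change g (φ a) s = _
      rw [hg]; rfl
    let l : S →ₛₗ[φ] S :=
      { toFun := id, map_add' := fun _ _ => rfl, map_smul' := fun a s => (hsm a s).symm }
    have hl : Function.Bijective l := Function.bijective_id
    have hs : IsSimpleModule B S := (LinearMap.isSimpleModule_iff_of_bijective l hl).1 hS
    exact ⟨⟨ModuleCat.of B S, hs, aux_self_hom S⟩, l, hl⟩
  · rintro ⟨U, hU, _⟩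
    let _ : Module A U := Module.compHom U φ
    let l : U →ₛₗ[φ] U :=
      { toFun := id, map_add' := fun _ _ => rfl, map_smul' := fun a s => rfl }
    have hl : Function.Bijective l := Function.bijective_id
    have hs : IsSimpleModule A U := (LinearMap.isSimpleModule_iff_of_bijective l hl).2 hU
    refine ⟨⟨ModuleCat.of A U, hs, fun x hx s => ?_⟩, l, hl⟩
    change φ x • (show U from s) = 0
    rw [(hker x).2 hx, zero_smul]
  · rintro ⟨S, hS, _⟩ ⟨S', hS', _⟩ ⟨U, hU, _⟩ ⟨U', hU', _⟩ ⟨l, hl⟩ ⟨l', hl'⟩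
    dsimp only at l l' hl hl'
    change Nonempty (S ≃ₗ[A] S') ↔ Nonempty (U ≃ₗ[B] U')
    let E := Equiv.ofBijective l hl
    let E' := Equiv.ofBijective l' hl'
    have hE : ∀ u, l (E.symm u) = u := E.apply_symm_apply
    have hE' : ∀ u, l' (E'.symm u) = u := E'.apply_symm_apply
    constructor
    · rintro ⟨e⟩
      refine ⟨LinearEquiv.ofBijective
        { toFun := fun u => l' (e (E.symm u)), map_add' := ?_, map_smul' := ?_ }
        (hl'.comp (e.bijective.comp E.symm.bijective))⟩
      · intro x y
        rw [← map_add, ← map_add]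
        refine congrArg l' (congrArg e (hl.1 ?_))
        rw [hE, map_add, hE, hE]
      · intro b x
        obtain ⟨a, rfl⟩ := hsurj b
        rw [RingHom.id_apply, ← map_smulₛₗ, ← map_smul]
        refine congrArg l' (congrArg e (hl.1 ?_))
        rw [hE, map_smulₛₗ, hE]
    · rintro ⟨e⟩
      refine ⟨LinearEquiv.ofBijective
        { toFun := fun u => E'.symm (e (l u)), map_add' := ?_, map_smul' := ?_ }
        (E'.symm.bijective.comp (e.bijective.comp hl))⟩
      · intro x y
        apply hl'.1
        simp only [map_add, hE']
      · intro b x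
        apply hl'.1
        simp only [map_smulₛₗ, hE', RingHom.id_apply]

end aux

/-- Let `I` be a two-sided ideal of an artin algebra `A`, with stable part
`I₀` (the largest idempotent two-sided ideal contained in `I`), and let `P₀` be the basic
projective `A`-module with `tr(P₀) = I₀`.  Then `|A| = |A/I| + st(I)`, where
`st(I) = |P₀|` and `A/I` is presented by any surjective ring homomorphism with kernel `I`. -/
theorem numIndec_eq_quotient_add_stableIndex
    (R A : Type) [CommRing R] [IsArtinianRing R] [Ring A] [Algebra R A] [Module.Finite R A]
    (I I₀ : TwoSidedIdeal A)
    (h₀idem : IsIdem A I₀) (h₀le : ∀ x ∈ I₀, x ∈ I)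
    (h₀max : ∀ J : TwoSidedIdeal A, IsIdem A J → (∀ x ∈ J, x ∈ I) → ∀ x ∈ J, x ∈ I₀)
    (P₀ : Type) [AddCommGroup P₀] [Module A P₀] [Module.Finite A P₀]
    (hproj : Module.Projective A P₀) (hbasic : isBasic A P₀)
    (htr : traceIdeal A P₀ = I₀.asIdeal)
    (B : Type) [Ring B] (φ : A →+* B) (hsurj : Function.Surjective φ)
    (hker : ∀ a : A, φ a = 0 ↔ a ∈ I) :
    numIndec A A = numIndec B B + numIndec A P₀ := by
  have : IsArtinianRing A := IsArtinianRing.of_finite R A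
  have : IsArtinianRing B := hsurj.isArtinianRing
  rw [aux_numIndec (A := A) A, aux_numIndec (A := A) P₀, aux_numIndec (A := B) B,
    aux_quot I B φ hsurj hker]
  have e1 : (fun S : ModuleCat.{0} A => IsSimpleModule A S ∧ ∃ f : A →ₗ[A] S, f ≠ 0) =
      fun S : ModuleCat.{0} A => IsSimpleModule A S := by
    funext S
    exact propext ⟨fun h => h.1, fun h => ⟨h, aux_self_hom S⟩⟩
  have e2 : (fun S : ModuleCat.{0} A => IsSimpleModule A S ∧ ∃ f : P₀ →ₗ[A] S, f ≠ 0) =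
      fun S : ModuleCat.{0} A => IsSimpleModule A S ∧ ¬ ∀ x ∈ I, ∀ s : S, x • s = 0 := by
    funext S
    refine propext (and_congr_right fun h => ?_)
    exact aux_hom_iff I I₀ h₀le h₀max P₀ htr S
  rw [e1, e2]
  refine aux_split _ _ ?_ aux_finite
  rintro X Y ⟨e⟩ h x hx s
  obtain ⟨y, rfl⟩ := e.surjective s
  rw [← map_smul, h x hx, map_zero]
end

section
/- Let A be a d-Gorenstein artin algebra (the injective dimension of A on both sides is at most d). Then Ω^d(A-mod) = Ω^{d+1}(A-mod), and consequently the global delooping level of A is at most d. -/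
universe u v

/-- The `n`-th Ext-group `Ext_A^n(M, N)` of left `A`-modules. -/
noncomputable def egrp (A : Type) [Ring A] (n : ℕ) (M N : Type) [AddCommGroup M] [Module A M]
    [AddCommGroup N] [Module A N] : Type :=
  ((_root_.Ext ℤ (ModuleCat A) n).obj (Opposite.op (ModuleCat.of A M))).obj
    (ModuleCat.of A N)

noncomputable instance (A : Type) [Ring A] (n : ℕ) (M N : Type) [AddCommGroup M] [Module A M]
    [AddCommGroup N] [Module A N] : AddCommGroup (egrp A n M N) :=
  inferInstanceAs (AddCommGroup (((_root_.Ext ℤ (ModuleCat A) n).obj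
    (Opposite.op (ModuleCat.of A M))).obj (ModuleCat.of A N)))

open CategoryTheory Limits ZeroObject

section ExactSub

variable (C : Type u) [Category.{v} C] [Abelian C]

/-- A short exact sequence `0 → X → Y → Z → 0` in the abelian category `C`. -/
def cSES (X Y Z : C) : Prop :=
  ∃ (i : X ⟶ Y) (p : Y ⟶ Z) (w : i ≫ p = 0),
    Mono i ∧ Epi p ∧ (ShortComplex.mk i p w).Exact

/-- `X` is a direct summand (retract) of `Y`. -/
def cretract (X Y : C) : Prop := ∃ (s : X ⟶ Y) (r : Y ⟶ X), s ≫ r = 𝟙 X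

/-- `Q` is a projective object of the exact category given by the extension-closed
full subcategory with object class `P`: every conflation ends in a `Q`-epimorphism. -/
def projIn (P : C → Prop) (Q : C) : Prop :=
  P Q ∧ ∀ (X Y Z : C) (i : X ⟶ Y) (p : Y ⟶ Z) (w : i ≫ p = 0),
    Mono i → Epi p → (ShortComplex.mk i p w).Exact → P X → P Y → P Z →
    ∀ g : Q ⟶ Z, ∃ h : Q ⟶ Y, h ≫ p = g

/-- `SyzChain C P W n X K` says that `K` is an `n`-th syzygy of `X` obtained from a
chain of conflations in the subcategory `P` with middle terms in the class `W` of
projective objects. -/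
def SyzChain (P W : C → Prop) : ℕ → C → C → Prop
  | 0, X, K => Nonempty (X ≅ K)
  | (n + 1), X, K => P K ∧ ∃ (Y Q : C), SyzChain P W n X Y ∧ W Q ∧ cSES C K Q Y

/-- The `n`-fold biproduct of copies of an object. -/
noncomputable def objPow (X : C) : ℕ → C
  | 0 => 0
  | (n + 1) => X ⊞ objPow X n

end ExactSub

/-- The class of finitely generated modules. -/
def fgP (A : Type) [Ring A] : ModuleCat.{0} A → Prop := fun M => Module.Finite A ↥M

/-- The class of finitely generated projective modules. -/
def fgProj (A : Type) [Ring A] : ModuleCat.{0} A → Prop :=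
  fun Q => Module.Finite A ↥Q ∧ Module.Projective A ↥Q

/-- `K` belongs to `Ωⁿ(A-mod)`: up to projective direct summands, `K` is a direct
summand of an `n`-th syzygy of a finitely generated module. -/
def inSyzCat (A : Type) [Ring A] (n : ℕ) (K : ModuleCat.{0} A) : Prop :=
  ∃ K₀ Q : ModuleCat.{0} A,
    (∃ M : ModuleCat.{0} A, fgP A M ∧ SyzChain (ModuleCat A) (fgP A) (fgProj A) n M K₀) ∧
    fgProj A Q ∧ cretract (ModuleCat A) K (K₀ ⊞ Q)

/-- Vanishing of the derived-category Ext. -/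
def EV (B : Type) [Ring B] (X T : Type) [AddCommGroup X] [Module B X] [AddCommGroup T] [Module B T]
    (n : ℕ) : Prop :=
  Subsingleton (Abelian.Ext (ModuleCat.of B X) (ModuleCat.of B T) n)

theorem ev_of_egrp (B : Type) [Ring B] (X T : Type) [AddCommGroup X] [Module B X] [AddCommGroup T]
    [Module B T] (n : ℕ) (h : Subsingleton (egrp B (n + 1) X T)) : EV B X T (n + 1) := by
  obtain ⟨P⟩ : Nonempty (ProjectiveResolution (ModuleCat.of B X)) :=
    HasProjectiveResolution.out
  have h1 : IsZero ((P.complex.linearYonedaObj ℤ (ModuleCat.of B T)).homology (n + 1)) := by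
    refine IsZero.of_iso ?_ (P.isoExt (R := ℤ) (n + 1) (ModuleCat.of B T)).symm
    exact @ModuleCat.isZero_of_subsingleton _ _ _ h
  rw [← HomologicalComplex.exactAt_iff_isZero_homology,
    HomologicalComplex.exactAt_iff' _ n (n + 1) (n + 2) (by simp) (by simp),
    ShortComplex.moduleCat_exact_iff] at h1
  refine ⟨fun a b => ?_⟩
  suffices H : ∀ a : Abelian.Ext (ModuleCat.of B X) (ModuleCat.of B T) (n + 1), a = 0 by
    rw [H a, H b]
  intro a
  obtain ⟨f, hf, rfl⟩ := P.extMk_surjective a (n + 2) rfl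
  rw [P.extMk_eq_zero_iff f _ _ _ n rfl]
  obtain ⟨g, hg⟩ := h1 f hf
  exact ⟨g, hg⟩

section
variable {B : Type} [Ring B] {X Y Z T : Type} [AddCommGroup X] [Module B X] [AddCommGroup Y]
  [Module B Y] [AddCommGroup Z] [Module B Z] [AddCommGroup T] [Module B T]

theorem ses_shortExact (f : X →ₗ[B] Y) (g : Y →ₗ[B] Z) (hf : Function.Injective f)
    (hg : Function.Surjective g) (hfg : Function.Exact f g) :
    ∃ w, (ShortComplex.mk (ModuleCat.ofHom f) (ModuleCat.ofHom g) w).ShortExact := by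
  refine ⟨by ext x; exact hfg.apply_apply_eq_zero x, ?_⟩
  have m : Mono (ModuleCat.ofHom f) := (ModuleCat.mono_iff_injective _).2 hf
  have e : Epi (ModuleCat.ofHom g) := (ModuleCat.epi_iff_surjective _).2 hg
  refine ⟨?_⟩
  exact (ShortComplex.ShortExact.moduleCat_exact_iff_function_exact _).mpr hfg

theorem ev_syz (f : X →ₗ[B] Y) (g : Y →ₗ[B] Z) (hf : Function.Injective f)
    (hg : Function.Surjective g) (hfg : Function.Exact f g) [Module.Projective B Y] (n : ℕ)
    (h : EV B Z T (n + 2)) : EV B X T (n + 1) := by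
  obtain ⟨w, hS⟩ := ses_shortExact f g hf hg hfg
  have : Projective (ModuleCat.of B Y) := (IsProjective.iff_projective _).1 ‹_›
  have H : ∀ x : Abelian.Ext (ModuleCat.of B X) (ModuleCat.of B T) (n + 1), x = 0 := by
    intro x
    obtain ⟨y, hy⟩ := Abelian.Ext.contravariant_sequence_exact₁ hS _ x
      (show 1 + (n + 1) = n + 2 by lia) (h.elim _ _)
    rw [← hy, Abelian.Ext.eq_zero_of_projective (P := ModuleCat.of B Y) y]
    simp
  exact ⟨fun a b => by rw [H a, H b]⟩

theorem ev_cosyz (f : X →ₗ[B] Y) (g : Y →ₗ[B] Z) (hf : Function.Injective f)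
    (hg : Function.Surjective g) (hfg : Function.Exact f g) [Module.Projective B Y] (n : ℕ)
    (h : EV B X T (n + 1)) : EV B Z T (n + 2) := by
  obtain ⟨w, hS⟩ := ses_shortExact f g hf hg hfg
  have : Projective (ModuleCat.of B Y) := (IsProjective.iff_projective _).1 ‹_›
  have H : ∀ x : Abelian.Ext (ModuleCat.of B Z) (ModuleCat.of B T) (n + 2), x = 0 := by
    intro x
    obtain ⟨y, hy⟩ := Abelian.Ext.contravariant_sequence_exact₃ hS _ x
      (Abelian.Ext.eq_zero_of_projective (P := ModuleCat.of B Y) _)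
      (show 1 + (n + 1) = n + 2 by lia)
    have : y = 0 := h.elim _ _
    rw [← hy, this]
    simp
  exact ⟨fun a b => by rw [H a, H b]⟩

theorem ev_one_of_extend (f : X →ₗ[B] Y) (g : Y →ₗ[B] Z) (hf : Function.Injective f)
    (hg : Function.Surjective g) (hfg : Function.Exact f g) [Module.Projective B Y]
    (h : ∀ u : X →ₗ[B] T, ∃ v : Y →ₗ[B] T, v ∘ₗ f = u) : EV B Z T 1 := by
  obtain ⟨w, hS⟩ := ses_shortExact f g hf hg hfg
  have : Projective (ModuleCat.of B Y) := (IsProjective.iff_projective _).1 ‹_›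
  have H : ∀ x : Abelian.Ext (ModuleCat.of B Z) (ModuleCat.of B T) 1, x = 0 := by
    intro x
    obtain ⟨y, hy⟩ := Abelian.Ext.contravariant_sequence_exact₃ hS _ x
      (Abelian.Ext.eq_zero_of_projective (P := ModuleCat.of B Y) _)
      (show 1 + 0 = 1 by lia)
    obtain ⟨u, rfl⟩ := Abelian.Ext.addEquiv₀.symm.surjective y
    obtain ⟨v, hv⟩ := h u.hom
    have : u = ModuleCat.ofHom f ≫ ModuleCat.ofHom v := by
      ext x; exact (congrArg (fun k => k x) hv).symm
    rw [← hy, Abelian.Ext.addEquiv₀_symm_apply, this, ← Abelian.Ext.mk₀_comp_mk₀]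
    exact hS.extClass_comp_assoc _
  exact ⟨fun a b => by rw [H a, H b]⟩

theorem extend_of_ev_one (f : X →ₗ[B] Y) (g : Y →ₗ[B] Z) (hf : Function.Injective f)
    (hg : Function.Surjective g) (hfg : Function.Exact f g) (h : EV B Z T 1)
    (u : X →ₗ[B] T) : ∃ v : Y →ₗ[B] T, v ∘ₗ f = u := by
  obtain ⟨w, hS⟩ := ses_shortExact f g hf hg hfg
  obtain ⟨y, hy⟩ := Abelian.Ext.contravariant_sequence_exact₁ hS _
    (Abelian.Ext.mk₀ (ModuleCat.ofHom u)) (show 1 + 0 = 1 by lia) (h.elim _ _)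
  obtain ⟨v, rfl⟩ := Abelian.Ext.addEquiv₀.symm.surjective y
  refine ⟨v.hom, ?_⟩
  rw [Abelian.Ext.addEquiv₀_symm_apply, Abelian.Ext.mk₀_comp_mk₀] at hy
  have := (Abelian.Ext.mk₀_bijective _ _).1 hy
  exact congrArg ModuleCat.Hom.hom this

theorem ev_congr_right {T' : Type} [AddCommGroup T'] [Module B T'] (e : T ≃ₗ[B] T') (n : ℕ)
    (h : EV B X T n) : EV B X T' n := by
  have H : ∀ x : Abelian.Ext (ModuleCat.of B X) (ModuleCat.of B T') n, x = 0 := by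
    intro x
    have h0 : x.comp (Abelian.Ext.mk₀ (ModuleCat.ofHom e.symm.toLinearMap)) (add_zero n) = 0 :=
      h.elim _ _
    have h1 : ModuleCat.ofHom e.symm.toLinearMap ≫ ModuleCat.ofHom e.toLinearMap = 𝟙 _ := by
      ext x; simp
    have := congrArg (fun z => z.comp (Abelian.Ext.mk₀ (ModuleCat.ofHom e.toLinearMap))
      (add_zero n)) h0
    simpa [h1] using this
  exact ⟨fun a b => by rw [H a, H b]⟩

theorem ev_congr_left (e : X ≃ₗ[B] Y) (n : ℕ)
    (h : EV B X T n) : EV B Y T n := by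
  have H : ∀ x : Abelian.Ext (ModuleCat.of B Y) (ModuleCat.of B T) n, x = 0 := by
    intro x
    have h0 : (Abelian.Ext.mk₀ (ModuleCat.ofHom e.toLinearMap)).comp x (zero_add n) = 0 :=
      h.elim _ _
    have h1 : ModuleCat.ofHom e.symm.toLinearMap ≫ ModuleCat.ofHom e.toLinearMap = 𝟙 _ := by
      ext x; simp
    have := congrArg (fun z => (Abelian.Ext.mk₀ (ModuleCat.ofHom e.symm.toLinearMap)).comp z
      (zero_add n)) h0
    simpa [h1] using this
  exact ⟨fun a b => by rw [H a, H b]⟩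
end

/-- Finitely generated modules with vanishing higher Ext into the ring. -/
def GoodMod (A : Type) [Ring A] (X : Type) [AddCommGroup X] [Module A X] : Prop :=
  Module.Finite A X ∧ ∀ n, EV A X A (n + 1)

/-- The dual of a linear map, linear over the opposite ring. -/
def dualM {A : Type} [Ring A] {X Y : Type} [AddCommGroup X] [Module A X] [AddCommGroup Y]
    [Module A Y] (f : X →ₗ[A] Y) : (Y →ₗ[A] A) →ₗ[Aᵐᵒᵖ] (X →ₗ[A] A) where
  toFun u := u ∘ₗ f
  map_add' _ _ := rfl
  map_smul' _ _ := rfl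

/-- The right regular module as a module over the opposite ring. -/
def opEquivA (A : Type) [Ring A] : Aᵐᵒᵖ ≃ₗ[Aᵐᵒᵖ] A where
  toFun u := u.unop
  invFun := MulOpposite.op
  left_inv _ := rfl
  right_inv _ := rfl
  map_add' _ _ := rfl
  map_smul' _ _ := rfl

section
variable {A : Type} [Ring A]

theorem proj_dual_free (n : ℕ) : Module.Projective Aᵐᵒᵖ ((Fin n → A) →ₗ[A] A) := by
  have : Module.Free Aᵐᵒᵖ A := Module.Free.of_equiv (opEquivA A)
  have : Module.Free Aᵐᵒᵖ ((Fin n → A) →ₗ[A] A) :=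
    Module.Free.of_equiv ((Pi.basisFun A (Fin n)).constr Aᵐᵒᵖ)
  infer_instance

variable {X : Type} [AddCommGroup X] [Module A X]

theorem good_ker [IsNoetherianRing A] (hX : GoodMod A X) {n : ℕ} (p : (Fin n → A) →ₗ[A] X)
    (hp : Function.Surjective p) : GoodMod A (LinearMap.ker p) := by
  refine ⟨inferInstance, fun m => ?_⟩
  exact ev_syz (LinearMap.ker p).subtype p (Submodule.injective_subtype _) hp
    (LinearMap.exact_subtype_ker_map p) m (hX.2 (m + 1))

theorem dual_inj {Y : Type} [AddCommGroup Y] [Module A Y] (p : Y →ₗ[A] X)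
    (hp : Function.Surjective p) : Function.Injective (dualM p) := by
  intro u v h
  ext x
  obtain ⟨y, rfl⟩ := hp x
  exact congrArg (fun k => k y) h

theorem dual_surj (hX : GoodMod A X) {n : ℕ} (p : (Fin n → A) →ₗ[A] X)
    (hp : Function.Surjective p) : Function.Surjective (dualM (LinearMap.ker p).subtype) :=
  extend_of_ev_one (LinearMap.ker p).subtype p (Submodule.injective_subtype _) hp
    (LinearMap.exact_subtype_ker_map p) (hX.2 0)

theorem dual_exact {n : ℕ} (p : (Fin n → A) →ₗ[A] X)
    (hp : Function.Surjective p) :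
    Function.Exact (dualM p) (dualM (LinearMap.ker p).subtype) := by
  intro u
  constructor
  · intro h
    have h' : LinearMap.ker p ≤ LinearMap.ker u := by
      intro x hx
      exact congrArg (fun k => k ⟨x, hx⟩) h
    refine ⟨(Submodule.liftQ _ u h') ∘ₗ (p.quotKerEquivOfSurjective hp).symm.toLinearMap, ?_⟩
    apply LinearMap.ext
    intro x
    have : (p.quotKerEquivOfSurjective hp).symm (p x) = Submodule.Quotient.mk x := by
      rw [LinearEquiv.symm_apply_eq]; rfl
    simp [dualM, this]
  · rintro ⟨v, rfl⟩
    ext x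
    simp [dualM]

theorem dual_ev [IsNoetherianRing A] (d : ℕ)
    (hR : ∀ (M : Type) [AddCommGroup M] [Module Aᵐᵒᵖ M] (n : ℕ), d ≤ n → EV Aᵐᵒᵖ M A (n + 1))
    (k : ℕ) : ∀ (X : Type) [AddCommGroup X] [Module A X], GoodMod A X → ∀ n, d ≤ n + k →
      EV Aᵐᵒᵖ (X →ₗ[A] A) A (n + 1) := by
  induction k with
  | zero => intro X _ _ _ n hn; exact hR _ n hn
  | succ k ih =>
    intro X _ _ hX n hn
    have := hX.1
    obtain ⟨m, p, hp⟩ := Module.Finite.exists_fin' A X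
    have := proj_dual_free (A := A) m
    exact ev_syz (dualM p) (dualM (LinearMap.ker p).subtype) (dual_inj p hp) (dual_surj hX p hp)
      (dual_exact p hp) n (ih _ (good_ker hX p hp) (n + 1) (by omega))

/-- Evaluation as a map of modules over the opposite ring. -/
def evalM (x : X) : (X →ₗ[A] A) →ₗ[Aᵐᵒᵖ] A where
  toFun u := u x
  map_add' _ _ := rfl
  map_smul' _ _ := rfl

theorem free_refl {n : ℕ} (θ : ((Fin n → A) →ₗ[A] A) →ₗ[Aᵐᵒᵖ] A) :
    ∃ g : Fin n → A, ∀ u, θ u = u g := by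
  refine ⟨fun j => θ (LinearMap.proj j), fun u => ?_⟩
  have hu : u = ∑ j, MulOpposite.op (u (Pi.single j 1)) • (LinearMap.proj j : (Fin n → A) →ₗ[A] A) := by
    apply LinearMap.ext
    intro x
    conv_lhs => rw [pi_eq_sum_univ' x]
    simp [LinearMap.sum_apply]
  conv_lhs => rw [hu]
  conv_rhs => rw [pi_eq_sum_univ' (fun j => θ (LinearMap.proj j))]
  simp

theorem good_torsionless [IsNoetherianRing A] (d : ℕ)
    (hR : ∀ (M : Type) [AddCommGroup M] [Module Aᵐᵒᵖ M] (n : ℕ), d ≤ n → EV Aᵐᵒᵖ M A (n + 1))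
    (hX : GoodMod A X) (x : X) (hx : ∀ u : X →ₗ[A] A, u x = 0) : x = 0 := by
  have := hX.1
  obtain ⟨n, p, hp⟩ := Module.Finite.exists_fin' A X
  have hY := good_ker hX p hp
  have := hY.1
  obtain ⟨m, q, hq⟩ := Module.Finite.exists_fin' A (LinearMap.ker p)
  have hZ := good_ker hY q hq
  obtain ⟨y, rfl⟩ := hp x
  have hk : LinearMap.ker (dualM (LinearMap.ker p).subtype) ≤ LinearMap.ker (evalM y) := by
    intro u hu
    obtain ⟨v, rfl⟩ := (dual_exact p hp u).1 hu
    exact hx v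
  let ψ := (Submodule.liftQ _ (evalM y) hk) ∘ₗ
    ((dualM (LinearMap.ker p).subtype).quotKerEquivOfSurjective (dual_surj hX p hp)).symm.toLinearMap
  have hψ : ∀ u, ψ (dualM (LinearMap.ker p).subtype u) = u y := by
    intro u
    have : ((dualM (LinearMap.ker p).subtype).quotKerEquivOfSurjective (dual_surj hX p hp)).symm
        (dualM (LinearMap.ker p).subtype u) = Submodule.Quotient.mk u := by
      rw [LinearEquiv.symm_apply_eq]; rfl
    simp only [ψ, LinearMap.comp_apply, LinearEquiv.coe_coe, this]
    rfl
  obtain ⟨θ, hθ⟩ := extend_of_ev_one (dualM q) (dualM (LinearMap.ker q).subtype) (dual_inj q hq)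
    (dual_surj hY q hq) (dual_exact q hq) (dual_ev d hR d _ hZ 0 (by omega)) ψ
  obtain ⟨g, hg⟩ := free_refl θ
  have key : y = (q g : Fin n → A) := by
    ext k
    have h1 := hψ (LinearMap.proj k)
    rw [← hθ, LinearMap.comp_apply, hg] at h1
    exact h1.symm
  rw [key]
  exact (q g).2

theorem good_cosyz [IsNoetherianRing A] [IsNoetherian Aᵐᵒᵖ A] (d : ℕ)
    (hR : ∀ (M : Type) [AddCommGroup M] [Module Aᵐᵒᵖ M] (n : ℕ), d ≤ n → EV Aᵐᵒᵖ M A (n + 1))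
    (hX : GoodMod A X) : ∃ (n : ℕ) (f : X →ₗ[A] (Fin n → A)), Function.Injective f ∧
      GoodMod A ((Fin n → A) ⧸ LinearMap.range f) := by
  have := hX.1
  obtain ⟨m, p, hp⟩ := Module.Finite.exists_fin' A X
  have : IsNoetherian Aᵐᵒᵖ ((Fin m → A) →ₗ[A] A) :=
    isNoetherian_of_linearEquiv ((Pi.basisFun A (Fin m)).constr Aᵐᵒᵖ)
  have : IsNoetherian Aᵐᵒᵖ (X →ₗ[A] A) := isNoetherian_of_injective _ (dual_inj p hp)
  obtain ⟨n, t, ht⟩ := Module.Finite.exists_fin (R := Aᵐᵒᵖ) (M := X →ₗ[A] A)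
  have hext : ∀ u : X →ₗ[A] A, ∃ v : (Fin n → A) →ₗ[A] A, v ∘ₗ LinearMap.pi t = u := by
    intro u
    have hu : u ∈ Submodule.span Aᵐᵒᵖ (Set.range t) := ht ▸ Submodule.mem_top
    obtain ⟨c, rfl⟩ := (Submodule.mem_span_range_iff_exists_fun _).1 hu
    refine ⟨∑ j, c j • LinearMap.proj j, ?_⟩
    ext x
    simp [LinearMap.sum_apply]
  have hinj : Function.Injective (LinearMap.pi t) := by
    rw [injective_iff_map_eq_zero]
    intro x hx
    refine good_torsionless d hR hX x fun u => ?_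
    obtain ⟨v, rfl⟩ := hext u
    simp [hx]
  have hex : Function.Exact (LinearMap.pi t) (LinearMap.range (LinearMap.pi t)).mkQ :=
    LinearMap.exact_map_mkQ_range _
  refine ⟨n, LinearMap.pi t, hinj, inferInstance, fun k => ?_⟩
  cases k with
  | zero => exact ev_one_of_extend _ _ hinj (Submodule.mkQ_surjective _) hex hext
  | succ k => exact ev_cosyz _ _ hinj (Submodule.mkQ_surjective _) hex k (hX.2 k)

theorem good_chain [IsNoetherianRing A] [IsNoetherian Aᵐᵒᵖ A] (d : ℕ)
    (hR : ∀ (M : Type) [AddCommGroup M] [Module Aᵐᵒᵖ M] (n : ℕ), d ≤ n → EV Aᵐᵒᵖ M A (n + 1))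
    (n : ℕ) : ∀ K : ModuleCat.{0} A, GoodMod A K → ∃ N : ModuleCat.{0} A, fgP A N ∧
      SyzChain (ModuleCat A) (fgP A) (fgProj A) n N K := by
  induction n with
  | zero => intro K hK; exact ⟨K, hK.1, ⟨Iso.refl _⟩⟩
  | succ n ih =>
    intro K hK
    obtain ⟨m, f, hf, hC⟩ := good_cosyz d hR hK
    obtain ⟨N, hN, hc⟩ := ih (ModuleCat.of A ((Fin m → A) ⧸ LinearMap.range f)) hC
    obtain ⟨w, hS⟩ := ses_shortExact f (LinearMap.range f).mkQ hf (Submodule.mkQ_surjective _)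
      (LinearMap.exact_map_mkQ_range _)
    refine ⟨N, hN, hK.1, _, ModuleCat.of A (Fin m → A), hc, ⟨?_, ?_⟩, ModuleCat.ofHom f,
      ModuleCat.ofHom (LinearMap.range f).mkQ, w, hS.mono_f, hS.epi_g, hS.exact⟩
    · exact inferInstanceAs (Module.Finite A (Fin m → A))
    · exact inferInstanceAs (Module.Projective A (Fin m → A))

theorem chain_ev (n : ℕ) : ∀ M K : ModuleCat.{0} A, fgP A M →
    SyzChain (ModuleCat A) (fgP A) (fgProj A) n M K →
    fgP A K ∧ ∀ m, EV A M A (n + m + 1) → EV A K A (m + 1) := by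
  induction n with
  | zero =>
    rintro M K hM ⟨e⟩
    have : Module.Finite A M := hM
    refine ⟨Module.Finite.equiv (M := M) e.toLinearEquiv, fun m h => ?_⟩
    rw [Nat.zero_add] at h
    exact ev_congr_left e.toLinearEquiv _ h
  | succ n ih =>
    rintro M K hM ⟨hK, Y, Q, hc, ⟨_, hQ⟩, i, p, w, hi, hp, hex⟩
    refine ⟨hK, fun m h => ?_⟩
    refine ev_syz i.hom p.hom ((ModuleCat.mono_iff_injective _).1 hi)
      ((ModuleCat.epi_iff_surjective _).1 hp)
      ((ShortComplex.ShortExact.moduleCat_exact_iff_function_exact _).1 hex) m ?_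
    refine (ih M Y hM hc).2 (m + 1) ?_
    have : n + (m + 1) + 1 = n + 1 + m + 1 := by omega
    rwa [this]

theorem chain_drop (n : ℕ) : ∀ M K : ModuleCat.{0} A,
    SyzChain (ModuleCat A) (fgP A) (fgProj A) (n + 1) M K →
    ∃ M', fgP A M' ∧ SyzChain (ModuleCat A) (fgP A) (fgProj A) n M' K := by
  induction n with
  | zero =>
    rintro M K ⟨hK, -⟩
    exact ⟨K, hK, ⟨Iso.refl _⟩⟩
  | succ n ih =>
    rintro M K ⟨hK, Y, Q, hc, hQ, hs⟩
    obtain ⟨M', hM', hc'⟩ := ih M Y hc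
    exact ⟨M', hM', hK, Y, Q, hc', hQ, hs⟩
end

/-- Let `A` be a `d`-Gorenstein artin algebra: the injective dimension
of `A` as a left and as a right module over itself is at most `d` (expressed by the
vanishing of `Ext^i(-, A)` for `i > d` on both sides).  Then
`Ω^d(A-mod) = Ω^(d+1)(A-mod)`, and consequently the global delooping level of `A` is at
most `d`. -/
theorem gorenstein_syzygy_stable_and_delooping_le
    (R A : Type) [CommRing R] [IsArtinianRing R] [Ring A] [Algebra R A] [Module.Finite R A]
    (d : ℕ)
    (hGorL : ∀ (M : ModuleCat.{0} A) (i : ℕ), d + 1 ≤ i → Subsingleton (egrp A i ↥M A))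
    (hGorR : ∀ (M : ModuleCat.{0} Aᵐᵒᵖ) (i : ℕ), d + 1 ≤ i →
      Subsingleton (egrp Aᵐᵒᵖ i ↥M Aᵐᵒᵖ)) :
    (∀ K : ModuleCat.{0} A, fgP A K → (inSyzCat A d K ↔ inSyzCat A (d + 1) K)) ∧
    (∀ M : ModuleCat.{0} A, fgP A M →
      ∀ K : ModuleCat.{0} A, SyzChain (ModuleCat A) (fgP A) (fgProj A) d M K →
        ∃ (N K' Q : ModuleCat.{0} A), fgP A N ∧
          SyzChain (ModuleCat A) (fgP A) (fgProj A) (d + 1) N K' ∧ fgProj A Q ∧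
          cretract (ModuleCat A) K (K' ⊞ Q)) := by

  have nA : IsNoetherianRing A := IsNoetherianRing.of_finite R A
  have nA' : IsNoetherian Aᵐᵒᵖ A := by
    have : IsNoetherian R A := inferInstance
    exact isNoetherian_of_tower R this
  have hR : ∀ (M : Type) [AddCommGroup M] [Module Aᵐᵒᵖ M] (n : ℕ), d ≤ n →
      EV Aᵐᵒᵖ M A (n + 1) := by
    intro M _ _ n hn
    exact ev_congr_right (opEquivA A) _
      (ev_of_egrp _ _ _ _ (hGorR (ModuleCat.of _ M) (n + 1) (by omega)))
  have key : ∀ M : ModuleCat.{0} A, fgP A M → ∀ K : ModuleCat.{0} A,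
      SyzChain (ModuleCat A) (fgP A) (fgProj A) d M K → ∃ N : ModuleCat.{0} A, fgP A N ∧
        SyzChain (ModuleCat A) (fgP A) (fgProj A) (d + 1) N K := by
    intro M hM K hc
    obtain ⟨h1, h2⟩ := chain_ev d M K hM hc
    exact good_chain d hR (d + 1) K ⟨h1, fun m => h2 m (ev_of_egrp _ _ _ _
      (hGorL M _ (by omega)))⟩
  refine ⟨fun K hK => ⟨?_, ?_⟩, ?_⟩
  · rintro ⟨K₀, Q, ⟨M, hM, hc⟩, hQ, hr⟩
    exact ⟨K₀, Q, key M hM K₀ hc, hQ, hr⟩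
  · rintro ⟨K₀, Q, ⟨M, hM, hc⟩, hQ, hr⟩
    exact ⟨K₀, Q, chain_drop d M K₀ hc, hQ, hr⟩
  · intro M hM K hc
    obtain ⟨N, hN, hc'⟩ := key M hM K hc
    refine ⟨N, K, ModuleCat.of A PUnit, hN, hc', ⟨?_, ?_⟩, biprod.inl, biprod.fst, by simp⟩
    · exact inferInstanceAs (Module.Finite A PUnit)
    · exact inferInstanceAs (Module.Projective A PUnit)
end
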